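/- Let V = ℍ ⊕ ℍ with complex structures I, J, K acting diagonally by left multiplication by i, j, k: A(x,u) = (a·x, a·u) for a = i, j, k. Set X_0 = (0,1), X_1 = (0,i), X_2 = (0,j), X_3 = (0,k) ∈ V, and define 2-forms Ω_A on V by Ω_A((x,u),(y,v)) = Re((a·x)·conj(y)) for a = i, j, k. Let F_0 be any alternating bilinear form on V that vanishes whenever one of its arguments lies in the second summand 0 ⊕ ℍ and is invariant under I, J and K (F_0(Az, Aw) = F_0(z,w) for A = I, J, K). Define the V-valued alternating bilinear map 𝓕(z,w) = F_0(z,w)·X_0 + Ω_I(z,w)·X_1 + Ω_J(z,w)·X_2 + Ω_K(z,w)·X_3. Then 𝓛_A 𝓕 = 𝓕 for each A ∈ {I, J, K}. -/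

import Mathlib

noncomputable section

/-- The quaternion `i`. -/
def quatI : Quaternion ℝ := ⟨0, 1, 0, 0⟩
/-- The quaternion `j`. -/
def quatJ : Quaternion ℝ := ⟨0, 0, 1, 0⟩
/-- The quaternion `k`. -/
def quatK : Quaternion ℝ := ⟨0, 0, 0, 1⟩

/-- `V = ℍ ⊕ ℍ`. -/
abbrev VH := Quaternion ℝ × Quaternion ℝ

/-- Diagonal left multiplication by a quaternion `a` on `V = ℍ ⊕ ℍ`;
for `a = i, j, k` these are the complex structures `I, J, K`. -/
def mulA (a : Quaternion ℝ) : VH → VH := fun z => (a * z.1, a * z.2)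

/-- The operator `𝓛_A` on `V`-valued bilinear maps:
`(𝓛_A B)(X,Y) = B(AX,AY) − A(B(AX,Y)) − A(B(X,AY))`. -/
def LL (A : VH → VH) (B : VH → VH → VH) : VH → VH → VH :=
  fun X Y => B (A X) (A Y) - A (B (A X) Y) - A (B X (A Y))

/-- The 2-forms `Ω_A((x,u),(y,v)) = Re((a·x)·conj y)` on `V = ℍ ⊕ ℍ`. -/
def OmV (a : Quaternion ℝ) : VH → VH → ℝ := fun z w => ((a * z.1) * star w.1).re

/-- `X_0 = (0,1)`, `X_1 = (0,i)`, `X_2 = (0,j)`, `X_3 = (0,k)`. -/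
def X0 : VH := (0, 1)
def X1 : VH := (0, quatI)
def X2 : VH := (0, quatJ)
def X3 : VH := (0, quatK)

@[simp] theorem quatI_re : quatI.re = 0 := rfl
@[simp] theorem quatI_imI : quatI.imI = 1 := rfl
@[simp] theorem quatI_imJ : quatI.imJ = 0 := rfl
@[simp] theorem quatI_imK : quatI.imK = 0 := rfl
@[simp] theorem quatJ_re : quatJ.re = 0 := rfl
@[simp] theorem quatJ_imI : quatJ.imI = 0 := rfl
@[simp] theorem quatJ_imJ : quatJ.imJ = 1 := rfl
@[simp] theorem quatJ_imK : quatJ.imK = 0 := rfl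
@[simp] theorem quatK_re : quatK.re = 0 := rfl
@[simp] theorem quatK_imI : quatK.imI = 0 := rfl
@[simp] theorem quatK_imJ : quatK.imJ = 0 := rfl
@[simp] theorem quatK_imK : quatK.imK = 1 := rfl

/-- A bilinear form invariant under a complex structure `A` is skew with respect to `A`. -/
theorem apply_mulA_left (F : VH →ₗ[ℝ] VH →ₗ[ℝ] ℝ) {a : Quaternion ℝ} (ha : a * a = -1)
    (hF : ∀ z w : VH, F (mulA a z) (mulA a w) = F z w) (z w : VH) :
    F (mulA a z) w = -F z (mulA a w) := by
  have hw : mulA a (mulA a w) = -w := by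
    ext1 <;> simp [mulA, ← mul_assoc, ha]
  rw [← hF z (mulA a w), hw, map_neg, neg_neg]

/-- With `𝓕(z,w) = F_0(z,w)·X_0 + Ω_I(z,w)·X_1 + Ω_J(z,w)·X_2 + Ω_K(z,w)·X_3`,
where `F_0` is an alternating bilinear form vanishing whenever one argument
lies in `0 ⊕ ℍ` and invariant under `I, J, K`, one has `𝓛_A 𝓕 = 𝓕` for each
`A ∈ {I, J, K}`. -/
theorem stmt9 (F0 : VH →ₗ[ℝ] VH →ₗ[ℝ] ℝ)
    (halt : ∀ z w : VH, F0 z w = - F0 w z)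
    (hvan : ∀ z w : VH, (z.1 = 0 → F0 z w = 0) ∧ (w.1 = 0 → F0 z w = 0))
    (hinv : ∀ a ∈ ({quatI, quatJ, quatK} : Set (Quaternion ℝ)),
      ∀ z w : VH, F0 (mulA a z) (mulA a w) = F0 z w) :
    ∀ a ∈ ({quatI, quatJ, quatK} : Set (Quaternion ℝ)),
      LL (mulA a)
        (fun z w => F0 z w • X0 + OmV quatI z w • X1
          + OmV quatJ z w • X2 + OmV quatK z w • X3)
        = fun z w => F0 z w • X0 + OmV quatI z w • X1
          + OmV quatJ z w • X2 + OmV quatK z w • X3 := by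
  intro a ha
  have hsq : a * a = -1 := by
    rcases ha with rfl | rfl | rfl <;> ext <;>
      simp [Quaternion.re_mul, Quaternion.imI_mul, Quaternion.imJ_mul, Quaternion.imK_mul,
        Quaternion.re_one, Quaternion.imI_one, Quaternion.imJ_one, Quaternion.imK_one]
  have hskew := apply_mulA_left F0 hsq (hinv a ha)
  funext z w
  simp only [LL, hinv a ha, hskew]
  generalize F0 z w = s
  generalize F0 z (mulA a w) = t
  rcases ha with rfl | rfl | rfl <;> ext <;>
    simp [mulA, OmV, X0, X1, X2, X3, Quaternion.re_mul, Quaternion.imI_mul, Quaternion.imJ_mul,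
      Quaternion.imK_mul] <;> ring
end
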